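/- For every real θ with 0 < θ < π/6, the identity (cot(2θ) − tan θ)·(cot θ · cot(2θ) − 1) − 3·(cot θ + cot(2θ)) = (cot⁴θ − 24·cot²θ + 15)/(4·cot θ) holds, and this quantity vanishes if and only if cot²θ = 12 + √129. -/

import Mathlib

open Real

/-- Double-angle formula for the cotangent. -/
theorem cot_two_mul_of_sin_ne_zero {θ : ℝ} (hs : sin θ ≠ 0) (hc : cos θ ≠ 0) :
    Real.cot (2 * θ) = (Real.cot θ ^ 2 - 1) / (2 * Real.cot θ) := by
  simp only [Real.cot_eq_cos_div_sin, sin_two_mul, cos_two_mul']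
  field_simp

theorem cot_pos_of_pos_of_lt_pi_div_two {θ : ℝ} (h0 : 0 < θ) (h1 : θ < π / 2) :
    0 < Real.cot θ := by
  rw [← Real.tan_inv_eq_cot]
  exact inv_pos.mpr (tan_pos_of_pos_of_lt_pi_div_two h0 h1)

theorem three_lt_cot_sq {θ : ℝ} (h0 : 0 < θ) (h1 : θ < π / 6) : 3 < Real.cot θ ^ 2 := by
  have hs : 0 < sin θ := sin_pos_of_pos_of_lt_pi h0 (by linarith [pi_pos])
  have hs' : sin θ < 1 / 2 := by
    rw [← sin_pi_div_six]
    exact sin_lt_sin_of_lt_of_le_pi_div_two (by linarith [pi_pos]) (by linarith [pi_pos]) h1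
  rw [Real.cot_eq_cos_div_sin, div_pow, lt_div_iff₀ (by positivity)]
  nlinarith [sin_sq_add_cos_sq θ]

/-- The larger root of `x ^ 2 - 24 * x + 15` is its only root exceeding `3`. -/
theorem sq_sub_add_eq_zero_iff {x : ℝ} (hx : 3 < x) :
    x ^ 2 - 24 * x + 15 = 0 ↔ x = 12 + √129 := by
  have hsq : √129 ^ 2 = 129 := sq_sqrt (by norm_num)
  have hlt : 9 < √129 := lt_sqrt_of_sq_lt (by norm_num)
  have hfac : x ^ 2 - 24 * x + 15 = (x - (12 + √129)) * (x - 12 + √129) := by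
    linear_combination hsq
  have hne : x - 12 + √129 ≠ 0 := by linarith
  rw [hfac, mul_eq_zero_iff_right hne, sub_eq_zero]

/-- Type G₂, edge `P₀^{α₁,α₂}`, harmonicity computation: for `θ ∈ (0, π/6)` the tension
field coefficient satisfies the displayed identity, and it vanishes iff
`cot²θ = 12 + √129`. -/
theorem stmt_12 (θ : ℝ) (h0 : 0 < θ) (h1 : θ < π / 6) :
    (Real.cot (2 * θ) - Real.tan θ) * (Real.cot θ * Real.cot (2 * θ) - 1) -
        3 * (Real.cot θ + Real.cot (2 * θ)) =
      (Real.cot θ ^ 4 - 24 * Real.cot θ ^ 2 + 15) / (4 * Real.cot θ) ∧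
    ((Real.cot (2 * θ) - Real.tan θ) * (Real.cot θ * Real.cot (2 * θ) - 1) -
        3 * (Real.cot θ + Real.cot (2 * θ)) = 0 ↔
      Real.cot θ ^ 2 = 12 + Real.sqrt 129) := by
  have hcot : 0 < Real.cot θ := cot_pos_of_pos_of_lt_pi_div_two h0 (by linarith [pi_pos])
  have hsin : 0 < sin θ := sin_pos_of_pos_of_lt_pi h0 (by linarith [pi_pos])
  have hcos : 0 < cos θ := cos_pos_of_mem_Ioo ⟨by linarith [pi_pos], by linarith [pi_pos]⟩
  have key : (Real.cot (2 * θ) - Real.tan θ) * (Real.cot θ * Real.cot (2 * θ) - 1) -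
        3 * (Real.cot θ + Real.cot (2 * θ)) =
      (Real.cot θ ^ 4 - 24 * Real.cot θ ^ 2 + 15) / (4 * Real.cot θ) := by
    rw [cot_two_mul_of_sin_ne_zero hsin.ne' hcos.ne', ← Real.cot_inv_eq_tan]
    field_simp
    ring
  refine ⟨key, ?_⟩
  rw [key, div_eq_zero_iff, or_iff_left (by positivity),
    ← sq_sub_add_eq_zero_iff (three_lt_cot_sq h0 h1), ← pow_mul]
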